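/- Let τ be a painted stable S-tree, v a vertex of τ, and (I,J,K,L) an allowed quadruple of flags at v. Then the standard relation Σ_α ε(α; I,J,K,L) m(τ(α)) lies in the ideal I_S, where α runs over the painted stable 2-partitions of the set F_τ(v) of flags at v. -/

import Mathlib

open scoped Classical
noncomputable section

namespace EMO

/-- `σ` is an unordered 2-partition of the set `X`: two distinct nonempty disjoint parts
whose union is `X`. -/
def IsTwoPartitionOn {γ : Type*} (X : Set γ) (σ : Set (Set γ)) : Prop :=
  ∃ A B : Set γ, σ = {A, B} ∧ A ≠ B ∧ A.Nonempty ∧ B.Nonempty ∧ Disjoint A B ∧ A ∪ B = X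

/-- unordered 2-partition of the whole set. -/
def IsTwoPartition {γ : Type*} (σ : Set (Set γ)) : Prop :=
  IsTwoPartitionOn Set.univ σ

/-- `δ(σ,τ)`: the number of nonempty pairwise distinct sets among the intersections
`A ∩ B`, `A ∈ σ`, `B ∈ τ`, minus 2. -/
def delta {γ : Type*} (σ τ : Set (Set γ)) : ℤ :=
  ({C : Set γ | C.Nonempty ∧ ∃ A ∈ σ, ∃ B ∈ τ, C = A ∩ B}.ncard : ℤ) - 2

/-- `a b σ c d` : the elements `a,b` lie in one part of `σ` and `c,d` in the other. -/
def SplitsPair {γ : Type*} (σ : Set (Set γ)) (a b c d : γ) : Prop :=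
  ∃ A ∈ σ, ∃ B ∈ σ, A ≠ B ∧ a ∈ A ∧ b ∈ A ∧ c ∈ B ∧ d ∈ B

/-- a painted stable 2-partition w.r.t. the set `W` of white elements: each part
contains a white element and has at least two elements. -/
def PaintedStablePart {γ : Type*} (W : Set γ) (σ : Set (Set γ)) : Prop :=
  IsTwoPartition σ ∧ ∀ A ∈ σ, (A ∩ W).Nonempty ∧ 2 ≤ A.ncard

/-- a good family of painted stable 2-partitions: pairwise `δ = 1`. -/
def GoodFamily {γ : Type*} (W : Set γ) (E : Set (Set (Set γ))) : Prop :=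
  (∀ σ ∈ E, PaintedStablePart W σ) ∧ ∀ σ ∈ E, ∀ σ' ∈ E, σ ≠ σ' → delta σ σ' = 1

/-- an allowed quadruple: pairwise distinct, and each of the pairs
`{i,j}`, `{k,l}`, `{k,j}`, `{i,l}` contains a white element. -/
def Allowed {γ : Type*} (W : Set γ) (i j k l : γ) : Prop :=
  i ≠ j ∧ i ≠ k ∧ i ≠ l ∧ j ≠ k ∧ j ≠ l ∧ k ≠ l ∧
  (i ∈ W ∨ j ∈ W) ∧ (k ∈ W ∨ l ∈ W) ∧ (k ∈ W ∨ j ∈ W) ∧ (i ∈ W ∨ l ∈ W)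

/-- `ε(σ; i,j,k,l)`. -/
def eps {γ : Type*} (σ : Set (Set γ)) (i j k l : γ) : ℤ :=
  if SplitsPair σ i j k l then 1 else if SplitsPair σ k j i l then -1 else 0

/-- A tree whose tails are bijectively labeled by `γ`: a finite graph
(vertices, flags, incidence map, involution) whose geometric realization is
connected and simply connected (edge count), together with a labeling of the tails. -/
structure LTree (γ : Type) where
  V : Type
  Fl : Type
  [finV : Finite V]
  [finF : Finite Fl]
  bd : Fl → V
  inv : Fl → Fl
  inv_inv : ∀ f, inv (inv f) = f
  label : γ → Fl
  label_fixed : ∀ s, inv (label s) = label s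
  label_inj : Function.Injective label
  label_surj : ∀ f, inv f = f → ∃ s, label s = f
  conn : ∀ v w : V, Relation.ReflTransGen (fun a b => ∃ f, bd f = a ∧ bd (inv f) = b) v w
  tree_count : Nat.card {f : Fl // inv f ≠ f} + 2 = 2 * Nat.card V

attribute [instance] LTree.finV LTree.finF

namespace LTree

variable {γ : Type} (τ : LTree γ)

/-- flags incident to a vertex. -/
def flagsAt (v : τ.V) : Set τ.Fl := {f | τ.bd f = v}

/-- adjacency avoiding the edge `{f, inv f}`. -/
def sideAdj (f : τ.Fl) (a b : τ.V) : Prop :=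
  ∃ g, g ≠ f ∧ g ≠ τ.inv f ∧ τ.bd g = a ∧ τ.bd (τ.inv g) = b

/-- labels lying on the `f`-side of the edge `{f, inv f}`. -/
def flagSide (f : τ.Fl) : Set γ :=
  {s | Relation.ReflTransGen (τ.sideAdj f) (τ.bd (τ.label s)) (τ.bd f)}

/-- the 2-partition `σ_e` of the labels determined by the edge `{f, inv f}`. -/
def flagPartition (f : τ.Fl) : Set (Set γ) := {τ.flagSide f, τ.flagSide (τ.inv f)}

/-- the family of 2-partitions of labels determined by the edges of `τ`. -/
def edgeFamily : Set (Set (Set γ)) := {σ | ∃ f, τ.inv f ≠ f ∧ τ.flagPartition f = σ}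

/-- painted stability: every vertex carries at least three flags, and every
end vertex carries a white tail. -/
def PaintedStable (W : Set γ) : Prop :=
  (∀ v : τ.V, 3 ≤ Nat.card {f : τ.Fl // τ.bd f = v}) ∧
  (∀ v : τ.V, Nat.card {f : τ.Fl // τ.bd f = v ∧ τ.inv f ≠ f} ≤ 1 →
    ∃ s ∈ W, τ.bd (τ.label s) = v)

/-- adjacency avoiding the vertex `v`. -/
def avoidAdj (v : τ.V) (a b : τ.V) : Prop :=
  a ≠ v ∧ b ≠ v ∧ ∃ g, τ.bd g = a ∧ τ.bd (τ.inv g) = b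

/-- the labels carried by the branch of `τ` at `v` starting with the flag `φ`. -/
def branchLabels (v : τ.V) (φ : τ.Fl) : Set γ :=
  {s | τ.label s = φ ∨
    (τ.inv φ ≠ φ ∧ Relation.ReflTransGen (τ.avoidAdj v) (τ.bd (τ.inv φ)) (τ.bd (τ.label s)))}

/-- the 2-partition of labels induced by a 2-partition `α` of the flags at `v`. -/
def inducedSPart (v : τ.V) (α : Set (Set τ.Fl)) : Set (Set γ) :=
  (fun A => ⋃ φ ∈ A, τ.branchLabels v φ) '' α

/-- painted stable 2-partitions of the set of flags at `v`. -/
def VertexParts (W : Set γ) (v : τ.V) : Set (Set (Set τ.Fl)) :=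
  {α | IsTwoPartitionOn (τ.flagsAt v) α ∧ PaintedStablePart W (τ.inducedSPart v α)}

/-- an allowed quadruple of (pairwise distinct) flags at the vertex `v`: there are
labels on the corresponding branches forming an allowed quadruple. -/
def AllowedFlags (W : Set γ) (v : τ.V) (I J K L : τ.Fl) : Prop :=
  I ∈ τ.flagsAt v ∧ J ∈ τ.flagsAt v ∧ K ∈ τ.flagsAt v ∧ L ∈ τ.flagsAt v ∧
  I ≠ J ∧ I ≠ K ∧ I ≠ L ∧ J ≠ K ∧ J ≠ L ∧ K ≠ L ∧
  ∃ i ∈ τ.branchLabels v I, ∃ j ∈ τ.branchLabels v J,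
    ∃ a ∈ τ.branchLabels v K, ∃ b ∈ τ.branchLabels v L, Allowed W i j a b

end LTree

/-- an `S`-isomorphism of labeled trees (flags mapped in the reverse direction). -/
structure SIso {γ : Type} (τ τ' : LTree γ) where
  vmap : τ.V ≃ τ'.V
  fmap : τ'.Fl ≃ τ.Fl
  bd_comp : ∀ f : τ'.Fl, τ'.bd f = vmap (τ.bd (fmap f))
  inv_comp : ∀ f : τ'.Fl, fmap (τ'.inv f) = τ.inv (fmap f)
  label_comp : ∀ s : γ, fmap (τ'.label s) = τ.label s

/-- a morphism `τ' → τ` of labeled trees contracting the edge `{e₁, inv e₁}` of `τ'`. -/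
structure Contraction {γ : Type} (τ' τ : LTree γ) (e₁ : τ'.Fl) where
  cF : τ.Fl → τ'.Fl
  cV : τ'.V → τ.V
  cF_inj : Function.Injective cF
  cF_range : Set.range cF = {f : τ'.Fl | f ≠ e₁ ∧ f ≠ τ'.inv e₁}
  cF_inv : ∀ f, cF (τ.inv f) = τ'.inv (cF f)
  cF_label : ∀ s : γ, cF (τ.label s) = τ'.label s
  cV_surj : Function.Surjective cV
  cV_bd : ∀ f : τ.Fl, cV (τ'.bd (cF f)) = τ.bd f
  cV_glue : cV (τ'.bd e₁) = cV (τ'.bd (τ'.inv e₁))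
  cV_almost_inj : ∀ v w : τ'.V, cV v = cV w →
    v = w ∨ (({v, w} : Set τ'.V) = {τ'.bd e₁, τ'.bd (τ'.inv e₁)})

/-- the polynomial ring `R_S = k[l_σ]` on variables indexed by painted stable
2-partitions. -/
abbrev PSP (γ : Type) (W : Set γ) := {σ : Set (Set γ) // PaintedStablePart W σ}

abbrev Rring (γ : Type) (W : Set γ) (k : Type) [CommRing k] := MvPolynomial (PSP γ W) k

/-- the variable `l_σ` (or `0` if `σ` is not painted stable). -/
def lvar (γ : Type) (W : Set γ) (k : Type) [CommRing k] (σ : Set (Set γ)) : Rring γ W k :=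
  if h : PaintedStablePart W σ then MvPolynomial.X ⟨σ, h⟩ else 0

/-- the element `R_{ijkl} = Σ_σ ε(σ; i,j,k,l) l_σ`. -/
def Rquad (γ : Type) (W : Set γ) (k : Type) [CommRing k] (i j a b : γ) : Rring γ W k :=
  ∑ᶠ σ : PSP γ W, eps σ.1 i j a b • MvPolynomial.X σ

/-- the ideal `I_S` generated by the `R_{ijkl}` (over allowed quadruples) and the
products `l_σ l_σ'` for crossing pairs `σ, σ'`. -/
def idealI (γ : Type) (W : Set γ) (k : Type) [CommRing k] : Ideal (Rring γ W k) :=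
  Ideal.span
    ({p | ∃ i j a b : γ, Allowed W i j a b ∧ p = Rquad γ W k i j a b} ∪
     {p | ∃ σ σ' : PSP γ W, (∃ i j a b : γ, Allowed W i j a b ∧
        SplitsPair σ.1 i j a b ∧ SplitsPair σ'.1 a j i b) ∧
        p = MvPolynomial.X σ * MvPolynomial.X σ'})

/-- the good monomial `∏_{σ ∈ E} l_σ` of a family `E` of 2-partitions. -/
def mFam (γ : Type) (W : Set γ) (k : Type) [CommRing k] (E : Set (Set (Set γ))) :
    Rring γ W k :=
  ∏ᶠ σ ∈ E, lvar γ W k σ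

/-- the combinatorial cohomology ring `H*_S = R_S/I_S`. -/
abbrev HS (γ : Type) (W : Set γ) (k : Type) [CommRing k] := Rring γ W k ⧸ idealI γ W k

/-- good families of painted stable 2-partitions (= iso classes of painted stable trees). -/
abbrev GoodFam (γ : Type) (W : Set γ) := {E : Set (Set (Set γ)) // GoodFamily W E}

/-- the free `k`-module `M_S` on the iso classes `μ(τ)` of painted stable `S`-trees,
encoded by their families of edge 2-partitions. -/
abbrev MS (γ : Type) (W : Set γ) (k : Type) [CommRing k] := GoodFam γ W →₀ k

/-- the basis element `μ(τ)` of `M_S` attached to the edge family `E` of `τ`. -/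
def muE (γ : Type) (W : Set γ) (k : Type) [CommRing k] (E : Set (Set (Set γ))) : MS γ W k :=
  if h : GoodFamily W E then Finsupp.single ⟨E, h⟩ 1 else 0

/-- the standard relation `r(τ, v; I,J,K,L) = Σ_α ε(α; I,J,K,L) μ(τ(α))`. -/
def stdRelH (γ : Type) (W : Set γ) (k : Type) [CommRing k]
    (τ : LTree γ) (v : τ.V) (I J K L : τ.Fl) : MS γ W k :=
  ∑ᶠ α ∈ τ.VertexParts W v, eps α I J K L • muE γ W k (τ.edgeFamily ∪ {τ.inducedSPart v α})

/-- the span `J_S` of the standard relations. -/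
def JS (γ : Type) (W : Set γ) (k : Type) [CommRing k] : Submodule k (MS γ W k) :=
  Submodule.span k {x | ∃ τ : LTree γ, τ.PaintedStable W ∧ ∃ (v : τ.V) (I J K L : τ.Fl),
    τ.AllowedFlags W v I J K L ∧ x = stdRelH γ W k τ v I J K L}

/-- the combinatorial homology `H_{*S} = M_S/J_S`. -/
abbrev HsLow (γ : Type) (W : Set γ) (k : Type) [CommRing k] := MS γ W k ⧸ JS γ W k

end EMO

namespace EMO

namespace LTree

variable {γ : Type} (τ : LTree γ)

open Relation

theorem sideAdj_symm (f : τ.Fl) {a b : τ.V} (h : τ.sideAdj f a b) : τ.sideAdj f b a := by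
  obtain ⟨g, h1, h2, rfl, rfl⟩ := h
  refine ⟨τ.inv g, ?_, ?_, rfl, by rw [τ.inv_inv]⟩
  · rintro rfl; exact h2 (τ.inv_inv g).symm
  · intro h; exact h1 (by rw [← τ.inv_inv g, h, τ.inv_inv])

theorem sideAdj_reach_symm (f : τ.Fl) {a b : τ.V} (h : ReflTransGen (τ.sideAdj f) a b) :
    ReflTransGen (τ.sideAdj f) b a :=
  have : Std.Symm (τ.sideAdj f) := ⟨fun _ _ => τ.sideAdj_symm f⟩
  symm h

theorem sideAdj_inv (f : τ.Fl) : τ.sideAdj (τ.inv f) = τ.sideAdj f := by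
  funext a b
  simp only [sideAdj, τ.inv_inv, eq_iff_iff]
  constructor <;> rintro ⟨g, h1, h2, h3⟩ <;> exact ⟨g, h2, h1, h3⟩

theorem avoidAdj_reach_symm (v : τ.V) {a b : τ.V} (h : ReflTransGen (τ.avoidAdj v) a b) :
    ReflTransGen (τ.avoidAdj v) b a := by
  have : Std.Symm (τ.avoidAdj v) := ⟨by
    rintro a b ⟨ha, hb, g, rfl, rfl⟩
    exact ⟨hb, ha, τ.inv g, rfl, by rw [τ.inv_inv]⟩⟩
  exact symm h

theorem sideAdj_of_avoidAdj {v : τ.V} {f : τ.Fl} (hf : τ.bd f = v) {a b : τ.V}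
    (h : τ.avoidAdj v a b) : τ.sideAdj f a b := by
  obtain ⟨ha, hb, g, rfl, rfl⟩ := h
  refine ⟨g, ?_, ?_, rfl, rfl⟩
  · rintro rfl; exact ha hf
  · rintro rfl; rw [τ.inv_inv] at hb; exact hb hf

/-- Every edge of a tree is a bridge. -/
theorem not_reach_inv {f : τ.Fl} (hf : τ.inv f ≠ f) :
    ¬ ReflTransGen (τ.sideAdj f) (τ.bd f) (τ.bd (τ.inv f)) := by
  intro hreach
  let G : SimpleGraph τ.V :=
    { Adj := fun a b => a ≠ b ∧ τ.sideAdj f a b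
      symm := ⟨fun a b h => ⟨h.1.symm, τ.sideAdj_symm f h.2⟩⟩
      loopless := ⟨fun a h => h.1 rfl⟩ }
  have hG : ∀ a b, ReflTransGen (τ.sideAdj f) a b → G.Reachable a b := by
    intro a b h
    induction h with
    | refl => exact .refl _
    | @tail b c _ h ih =>
      by_cases hbc : b = c
      · exact hbc ▸ ih
      · exact ih.trans (SimpleGraph.Adj.reachable (G := G) ⟨hbc, h⟩)
  have hpre : G.Preconnected := by
    intro a b
    have h := τ.conn a b
    induction h with
    | refl => exact .refl _
    | @tail b c _ h ih =>
      refine ih.trans ?_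
      obtain ⟨g, rfl, rfl⟩ := h
      by_cases h1 : g = f
      · subst h1; exact hG _ _ hreach
      by_cases h2 : g = τ.inv f
      · subst h2; rw [τ.inv_inv]; exact (hG _ _ hreach).symm
      exact hG _ _ (.single ⟨g, h1, h2, rfl, rfl⟩)
  have : Nonempty τ.V := ⟨τ.bd f⟩
  have := Fintype.ofFinite τ.V
  have := Fintype.ofFinite τ.Fl
  have hcard := (SimpleGraph.Connected.mk hpre).card_vert_le_card_edgeSet_add_one
  have hdart := G.dart_card_eq_twice_card_edges
  have hcount := τ.tree_count
  have hsurj : Fintype.card G.Dart ≤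
      ((Finset.univ.filter fun g => τ.inv g ≠ g) \ {f, τ.inv f}).card := by
    have hflag : ∀ d : G.Dart, ∃ g, (g ≠ f ∧ g ≠ τ.inv f) ∧ τ.bd g = d.fst ∧
        τ.bd (τ.inv g) = d.snd := fun d => by
      obtain ⟨g, h1, h2, h3, h4⟩ := d.adj.2
      exact ⟨g, ⟨h1, h2⟩, h3, h4⟩
    choose φ hφ hφ1 hφ2 using hflag
    rw [← Finset.card_univ]
    refine Finset.card_le_card_of_injOn φ ?_ ?_
    · intro d _
      have : τ.inv (φ d) ≠ φ d := fun h => d.adj.1 (by rw [← hφ1, ← hφ2, h])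
      simp [this, hφ d]
    · intro d _ d' _ h
      ext
      · rw [← hφ1, ← hφ1, h]
      · rw [← hφ2, ← hφ2, h]
  have hsub : {f, τ.inv f} ⊆ Finset.univ.filter fun g => τ.inv g ≠ g := ?_
  · have hle := Finset.card_le_card hsub
    rw [Finset.card_sdiff_of_subset hsub, Finset.card_pair (Ne.symm hf)] at hsurj
    rw [Finset.card_pair (Ne.symm hf)] at hle
    rw [Nat.card_eq_fintype_card, Fintype.card_subtype] at hcount
    rw [Nat.card_eq_fintype_card] at hcount hcard
    rw [Nat.card_eq_fintype_card, ← SimpleGraph.edgeFinset_card] at hcard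
    omega
  · intro g
    simp only [Finset.mem_insert, Finset.mem_singleton, Finset.mem_filter, Finset.mem_univ,
      true_and]
    rintro (rfl | rfl)
    · exact hf
    · rw [τ.inv_inv]; exact hf.symm

theorem branchLabels_of_fixed {v : τ.V} {φ : τ.Fl} (h : τ.inv φ = φ) :
    τ.branchLabels v φ = {s | τ.label s = φ} := by
  ext s; simp [branchLabels, h]

theorem branchLabels_eq_flagSide {v : τ.V} {φ : τ.Fl} (hv : τ.bd φ = v) (h : τ.inv φ ≠ φ) :
    τ.branchLabels v φ = τ.flagSide (τ.inv φ) := by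
  ext s
  simp only [branchLabels, flagSide, Set.mem_ofPred_eq, sideAdj_inv]
  constructor
  · rintro (rfl | ⟨-, hs⟩)
    · exact absurd (τ.label_fixed s) h
    · exact τ.sideAdj_reach_symm _ (ReflTransGen.mono (fun _ _ => τ.sideAdj_of_avoidAdj hv) _ _ hs)
  · intro hs
    refine .inr ⟨h, ?_⟩
    replace hs := τ.sideAdj_reach_symm _ hs
    have hne : ∀ x, ReflTransGen (τ.sideAdj φ) (τ.bd (τ.inv φ)) x → x ≠ v := by
      rintro x hx rfl
      exact τ.not_reach_inv h (hv ▸ τ.sideAdj_reach_symm _ hx)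
    generalize τ.bd (τ.label s) = y at hs
    induction hs with
    | refl => exact .refl
    | @tail b c hb hbc ih =>
      refine ih.tail ⟨hne _ hb, hne _ (hb.tail hbc), ?_⟩
      obtain ⟨g, -, -, h1, h2⟩ := hbc
      exact ⟨g, h1, h2⟩

theorem disjoint_flagSide {f : τ.Fl} (hf : τ.inv f ≠ f) :
    Disjoint (τ.flagSide f) (τ.flagSide (τ.inv f)) := by
  rw [Set.disjoint_left]
  intro s h1 h2
  simp only [flagSide, Set.mem_ofPred_eq, sideAdj_inv] at h1 h2
  exact τ.not_reach_inv hf ((τ.sideAdj_reach_symm _ h1).trans h2)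

theorem reach_bd_or_reach_inv (f : τ.Fl) (v : τ.V) :
    ReflTransGen (τ.sideAdj f) v (τ.bd f) ∨
      ReflTransGen (τ.sideAdj f) v (τ.bd (τ.inv f)) := by
  have h := τ.conn (τ.bd f) v
  induction h with
  | refl => exact .inl .refl
  | @tail b c _ h ih =>
    obtain ⟨g, rfl, rfl⟩ := h
    by_cases h1 : g = f
    · subst h1; exact .inr .refl
    by_cases h2 : g = τ.inv f
    · subst h2; rw [τ.inv_inv]; exact .inl .refl
    have := τ.sideAdj_symm f ⟨g, h1, h2, rfl, rfl⟩
    exact ih.imp (ReflTransGen.head this) (ReflTransGen.head this)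

theorem flagSide_union (f : τ.Fl) : τ.flagSide f ∪ τ.flagSide (τ.inv f) = Set.univ := by
  refine Set.eq_univ_of_forall fun s => ?_
  have := τ.reach_bd_or_reach_inv f (τ.bd (τ.label s))
  simpa only [flagSide, Set.mem_union, Set.mem_ofPred_eq, sideAdj_inv] using this

theorem exists_mem_branchLabels (v : τ.V) (s : γ) :
    ∃ φ ∈ τ.flagsAt v, s ∈ τ.branchLabels v φ := by
  have key : ∀ x, x = v ∨ ∃ φ, τ.bd φ = v ∧ τ.inv φ ≠ φ ∧
      ReflTransGen (τ.avoidAdj v) (τ.bd (τ.inv φ)) x := by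
    intro x
    have h := τ.conn v x
    induction h with
    | refl => exact .inl rfl
    | @tail b c _ h ih =>
      by_cases hc : c = v
      · exact .inl hc
      right
      obtain ⟨g, hg1, hg2⟩ := h
      by_cases hb : b = v
      · subst hb
        refine ⟨g, hg1, fun h => hc ?_, hg2 ▸ .refl⟩
        rw [← hg2, h, hg1]
      · obtain rfl | ⟨φ, h1, h2, h3⟩ := ih
        · exact absurd rfl hb
        · exact ⟨φ, h1, h2, h3.tail ⟨hb, hc, g, hg1, hg2⟩⟩
  obtain h | ⟨φ, h1, h2, h3⟩ := key (τ.bd (τ.label s))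
  · exact ⟨τ.label s, h, .inl rfl⟩
  · exact ⟨φ, h1, .inr ⟨h2, h3⟩⟩

theorem eq_of_mem_branchLabels {v : τ.V} {φ ψ : τ.Fl} (hφ : τ.bd φ = v) (hψ : τ.bd ψ = v)
    {s : γ} (h1 : s ∈ τ.branchLabels v φ) (h2 : s ∈ τ.branchLabels v ψ) : φ = ψ := by
  have tail_ne : ∀ χ, τ.bd χ = v → τ.inv χ ≠ χ → s ∈ τ.branchLabels v χ →
      τ.bd (τ.label s) ≠ v := by
    intro χ hv hχ hs h
    rw [τ.branchLabels_eq_flagSide hv hχ] at hs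
    simp only [flagSide, Set.mem_ofPred_eq, sideAdj_inv, h] at hs
    exact τ.not_reach_inv hχ (hv ▸ hs)
  by_cases f1 : τ.inv φ = φ <;> by_cases f2 : τ.inv ψ = ψ
  · rw [τ.branchLabels_of_fixed f1] at h1
    rw [τ.branchLabels_of_fixed f2] at h2
    exact h1.symm.trans h2
  · rw [τ.branchLabels_of_fixed f1] at h1
    exact absurd (h1.symm ▸ hφ) (tail_ne ψ hψ f2 h2)
  · rw [τ.branchLabels_of_fixed f2] at h2
    exact absurd (h2.symm ▸ hψ) (tail_ne φ hφ f1 h1)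
  · by_contra hne
    have h1' := h1
    rw [τ.branchLabels_eq_flagSide hφ f1] at h1
    simp only [flagSide, Set.mem_ofPred_eq, sideAdj_inv] at h1
    obtain rfl | ⟨-, h2⟩ := h2
    · exact f2 (τ.label_fixed s)
    replace h2 := (ReflTransGen.mono (fun _ _ => τ.sideAdj_of_avoidAdj hφ) _ _ h2).trans h1
    have hstep : τ.sideAdj φ (τ.bd φ) (τ.bd (τ.inv ψ)) := by
      refine ⟨ψ, Ne.symm hne, ?_, hψ.trans hφ.symm, rfl⟩
      rintro rfl
      exact τ.not_reach_inv f1 (by rw [hφ, hψ])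
    exact τ.not_reach_inv f1 (.head hstep h2)

/-- The side of an edge not containing `v` lies in a single branch at `v`. -/
theorem eq_of_mem_flagSide {v : τ.V} {f : τ.Fl}
    (hv : ¬ ReflTransGen (τ.sideAdj f) v (τ.bd f)) {φ ψ : τ.Fl}
    (hφ : τ.bd φ = v) (hψ : τ.bd ψ = v) {s t : γ}
    (hs : s ∈ τ.branchLabels v φ) (ht : t ∈ τ.branchLabels v ψ)
    (hs' : s ∈ τ.flagSide f) (ht' : t ∈ τ.flagSide f) : φ = ψ := by
  have path : ∀ u ∈ τ.flagSide f,
      ReflTransGen (τ.avoidAdj v) (τ.bd f) (τ.bd (τ.label u)) := by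
    intro u hu
    replace hu := τ.sideAdj_reach_symm _ hu
    have hne : ∀ x, ReflTransGen (τ.sideAdj f) (τ.bd f) x → x ≠ v := by
      rintro x hx rfl
      exact hv (τ.sideAdj_reach_symm _ hx)
    generalize τ.bd (τ.label u) = y at hu
    induction hu with
    | refl => exact .refl
    | @tail b c hb hbc ih =>
      refine ih.tail ⟨hne _ hb, hne _ (hb.tail hbc), ?_⟩
      obtain ⟨g, -, -, h1, h2⟩ := hbc
      exact ⟨g, h1, h2⟩
  have hst := (τ.avoidAdj_reach_symm v (path s hs')).trans (path t ht')
  refine τ.eq_of_mem_branchLabels hφ hψ (s := t) ?_ ht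
  obtain rfl | ⟨h1, h2⟩ := hs
  · exact absurd (hφ ▸ hs') hv
  · exact .inr ⟨h1, h2.trans hst⟩

theorem not_splitsPair_flagPartition {v : τ.V} {f : τ.Fl} (hf : τ.inv f ≠ f)
    {I J K L : τ.Fl} (hI : τ.bd I = v) (hJ : τ.bd J = v) (hK : τ.bd K = v) (hL : τ.bd L = v)
    (hIJ : I ≠ J) (hKL : K ≠ L) {i j a b : γ}
    (hi : i ∈ τ.branchLabels v I) (hj : j ∈ τ.branchLabels v J)
    (ha : a ∈ τ.branchLabels v K) (hb : b ∈ τ.branchLabels v L) :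
    ¬ SplitsPair (τ.flagPartition f) i j a b := by
  rintro ⟨A, hA, B, hB, hAB, h1, h2, h3, h4⟩
  have key : ∀ A B, A ∈ τ.flagPartition f → B ∈ τ.flagPartition f → A ≠ B →
      ∃ g, A = τ.flagSide g ∧ B = τ.flagSide (τ.inv g) ∧ τ.inv g ≠ g := by
    rintro A B (rfl | rfl) (rfl | rfl) h
    · exact absurd rfl h
    · exact ⟨f, rfl, rfl, hf⟩
    · exact ⟨τ.inv f, rfl, by rw [τ.inv_inv], by rw [τ.inv_inv]; exact hf.symm⟩
    · exact absurd rfl h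
  obtain ⟨g, rfl, rfl, hg⟩ := key A B hA hB hAB
  by_cases hv : ReflTransGen (τ.sideAdj g) v (τ.bd g)
  · refine hKL (τ.eq_of_mem_flagSide (f := τ.inv g) (fun h => ?_) hK hL ha hb h3 h4)
    rw [sideAdj_inv] at h
    exact τ.not_reach_inv hg ((τ.sideAdj_reach_symm _ hv).trans h)
  · exact hIJ (τ.eq_of_mem_flagSide hv hI hJ hi hj h1 h2)

/-- The set of labels carried by a set of flags at `v`. -/
def labelsOf (v : τ.V) (A : Set τ.Fl) : Set γ := ⋃ φ ∈ A, τ.branchLabels v φ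

theorem mem_labelsOf_iff {v : τ.V} {A : Set τ.Fl} (hA : A ⊆ τ.flagsAt v) {φ : τ.Fl}
    (hφ : φ ∈ τ.flagsAt v) {s : γ} (hs : s ∈ τ.branchLabels v φ) :
    s ∈ τ.labelsOf v A ↔ φ ∈ A := by
  simp only [labelsOf, Set.mem_iUnion, exists_prop]
  constructor
  · rintro ⟨ψ, hψ, h⟩
    rwa [τ.eq_of_mem_branchLabels hφ (hA hψ) hs h]
  · exact fun h => ⟨φ, h, hs⟩

theorem labelsOf_injOn {v : τ.V} (hne : ∀ φ ∈ τ.flagsAt v, (τ.branchLabels v φ).Nonempty) :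
    Set.InjOn (τ.labelsOf v) {A | A ⊆ τ.flagsAt v} := by
  intro A hA B hB h
  ext φ
  by_cases hφ : φ ∈ τ.flagsAt v
  · obtain ⟨s, hs⟩ := hne φ hφ
    rw [← τ.mem_labelsOf_iff hA hφ hs, ← τ.mem_labelsOf_iff hB hφ hs, h]
  · exact iff_of_false (fun h => hφ (hA h)) (fun h => hφ (hB h))

end LTree

theorem IsTwoPartitionOn.subset {γ : Type*} {X : Set γ} {σ : Set (Set γ)}
    (h : IsTwoPartitionOn X σ) {A : Set γ} (hA : A ∈ σ) : A ⊆ X := by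
  obtain ⟨B, C, rfl, -, -, -, -, rfl⟩ := h
  obtain rfl | rfl := hA
  · exact Set.subset_union_left
  · exact Set.subset_union_right

theorem IsTwoPartitionOn.disjoint {γ : Type*} {X : Set γ} {σ : Set (Set γ)}
    (h : IsTwoPartitionOn X σ) {A B : Set γ} (hA : A ∈ σ) (hB : B ∈ σ) (hAB : A ≠ B) :
    Disjoint A B := by
  obtain ⟨C, D, rfl, -, -, -, hd, -⟩ := h
  obtain rfl | rfl := hA <;> obtain rfl | rfl := hB
  · exact absurd rfl hAB
  · exact hd
  · exact hd.symm
  · exact absurd rfl hAB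

theorem IsTwoPartitionOn.eq_pair {γ : Type*} {X : Set γ} {σ : Set (Set γ)}
    (h : IsTwoPartitionOn X σ) {A B : Set γ} (hA : A ∈ σ) (hB : B ∈ σ) (hAB : A ≠ B) :
    σ = {A, B} ∧ A ∪ B = X := by
  obtain ⟨C, D, rfl, -, -, -, -, rfl⟩ := h
  obtain rfl | rfl := hA <;> obtain rfl | rfl := hB
  · exact absurd rfl hAB
  · exact ⟨rfl, rfl⟩
  · exact ⟨Set.pair_comm _ _, Set.union_comm _ _⟩
  · exact absurd rfl hAB

theorem Allowed.swap {γ : Type*} {W : Set γ} {i j a b : γ} (h : Allowed W i j a b) :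
    Allowed W a j i b := by
  obtain ⟨h1, h2, h3, h4, h5, h6, h7, h8, h9, h10⟩ := h
  exact ⟨h4.symm, h2.symm, h6, h1.symm, h5, h3, h9, h10, h7, h8⟩

theorem exists_crossing_white {γ : Type*} {W A B T : Set γ} {i j a b x y w : γ}
    (hal : Allowed W i j a b) (hAB : A ∪ B = Set.univ)
    (hi : i ∈ A) (hj : j ∈ A) (ha : a ∈ B) (hb : b ∈ B)
    (hij : i ∈ T → j ∉ T) (hia : i ∈ T → a ∉ T)
    (hjb : j ∈ T → b ∉ T) (hab : a ∈ T → b ∉ T)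
    (hx : x ∈ A ∩ T) (hy : y ∈ B ∩ T) (hw : w ∈ W) (hwT : w ∈ T) :
    ∃ p ∈ A ∩ T, ∃ q ∈ A \ T, ∃ r ∈ B \ T, ∃ s ∈ B ∩ T,
      (p ∈ W ∧ r ∈ W) ∨ (q ∈ W ∧ s ∈ W) := by
  have hq : ∃ q, q ∈ A \ T := by
    by_cases h : i ∈ T
    · exact ⟨j, hj, hij h⟩
    · exact ⟨i, hi, h⟩
  have hr : ∃ r, r ∈ B \ T := by
    by_cases h : a ∈ T
    · exact ⟨b, hb, hab h⟩
    · exact ⟨a, ha, h⟩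
  obtain ⟨q, hq⟩ := hq
  obtain ⟨r, hr⟩ := hr
  have main : ∀ c ∈ A, ∀ d ∈ B, c ∈ W → d ∈ W → (c ∈ T → d ∉ T) →
      ∃ p ∈ A ∩ T, ∃ q ∈ A \ T, ∃ r ∈ B \ T, ∃ s ∈ B ∩ T,
        (p ∈ W ∧ r ∈ W) ∨ (q ∈ W ∧ s ∈ W) := by
    intro c hc d hd hcW hdW hcd
    by_cases h1 : c ∈ T
    · exact ⟨c, ⟨hc, h1⟩, q, hq, d, ⟨hd, hcd h1⟩, y, hy, .inl ⟨hcW, hdW⟩⟩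
    by_cases h2 : d ∈ T
    · exact ⟨x, hx, c, ⟨hc, h1⟩, r, hr, d, ⟨hd, h2⟩, .inr ⟨hcW, hdW⟩⟩
    obtain h | h : w ∈ A ∪ B := hAB ▸ Set.mem_univ w
    · exact ⟨w, ⟨h, hwT⟩, c, ⟨hc, h1⟩, d, ⟨hd, h2⟩, y, hy, .inl ⟨hw, hdW⟩⟩
    · exact ⟨x, hx, c, ⟨hc, h1⟩, d, ⟨hd, h2⟩, w, ⟨h, hwT⟩, .inr ⟨hcW, hw⟩⟩
  have : (i ∈ W ∧ a ∈ W) ∨ (j ∈ W ∧ b ∈ W) := by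
    obtain ⟨-, -, -, -, -, -, h⟩ := hal
    clear * - h
    tauto
  obtain ⟨h1, h2⟩ | ⟨h1, h2⟩ := this
  · exact main i hi a ha h1 h2 hia
  · exact main j hj b hb h1 h2 hjb

namespace LTree

variable {γ : Type} (τ : LTree γ)

theorem inducedSPart_eq_image (v : τ.V) (α : Set (Set τ.Fl)) :
    τ.inducedSPart v α = τ.labelsOf v '' α := rfl

theorem splitsPair_inducedSPart_iff {v : τ.V} {α : Set (Set τ.Fl)}
    (hα : IsTwoPartitionOn (τ.flagsAt v) α) {I J K L : τ.Fl}
    (hI : I ∈ τ.flagsAt v) (hJ : J ∈ τ.flagsAt v) (hK : K ∈ τ.flagsAt v)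
    (hL : L ∈ τ.flagsAt v) {i j a b : γ}
    (hi : i ∈ τ.branchLabels v I) (hj : j ∈ τ.branchLabels v J)
    (ha : a ∈ τ.branchLabels v K) (hb : b ∈ τ.branchLabels v L) :
    SplitsPair (τ.inducedSPart v α) i j a b ↔ SplitsPair α I J K L := by
  rw [inducedSPart_eq_image]
  constructor
  · rintro ⟨_, ⟨A, hA, rfl⟩, _, ⟨B, hB, rfl⟩, hne, h1, h2, h3, h4⟩
    have sA := hα.subset hA
    have sB := hα.subset hB
    exact ⟨A, hA, B, hB, fun h => hne (h ▸ rfl), (τ.mem_labelsOf_iff sA hI hi).1 h1,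
      (τ.mem_labelsOf_iff sA hJ hj).1 h2, (τ.mem_labelsOf_iff sB hK ha).1 h3,
      (τ.mem_labelsOf_iff sB hL hb).1 h4⟩
  · rintro ⟨A, hA, B, hB, hne, h1, h2, h3, h4⟩
    have sA := hα.subset hA
    have sB := hα.subset hB
    refine ⟨_, ⟨A, hA, rfl⟩, _, ⟨B, hB, rfl⟩, fun h => ?_, (τ.mem_labelsOf_iff sA hI hi).2 h1,
      (τ.mem_labelsOf_iff sA hJ hj).2 h2, (τ.mem_labelsOf_iff sB hK ha).2 h3,
      (τ.mem_labelsOf_iff sB hL hb).2 h4⟩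
    have h5 := (τ.mem_labelsOf_iff sB hI hi).1 (h ▸ (τ.mem_labelsOf_iff sA hI hi).2 h1)
    exact Set.disjoint_left.1 (hα.disjoint hA hB hne) h1 h5

/-- A 2-partition of the labels that cuts no branch at `v` is induced by a 2-partition of the
flags at `v`. -/
theorem exists_inducedSPart_eq {v : τ.V}
    (hne : ∀ φ ∈ τ.flagsAt v, (τ.branchLabels v φ).Nonempty) {A B : Set γ}
    (hA : A.Nonempty) (hB : B.Nonempty) (hd : Disjoint A B)
    (hcut : ∀ φ ∈ τ.flagsAt v, τ.branchLabels v φ ⊆ A ∨ τ.branchLabels v φ ⊆ B) :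
    ∃ α, IsTwoPartitionOn (τ.flagsAt v) α ∧ τ.inducedSPart v α = {A, B} := by
  let pull : Set γ → Set τ.Fl := fun C => {φ | φ ∈ τ.flagsAt v ∧ τ.branchLabels v φ ⊆ C}
  have hpull : ∀ C D : Set γ, Disjoint C D →
      (∀ φ ∈ τ.flagsAt v, τ.branchLabels v φ ⊆ C ∨ τ.branchLabels v φ ⊆ D) →
      τ.labelsOf v (pull C) = C := by
    intro C D hCD hcut
    ext s
    obtain ⟨φ, hφ, hs⟩ := τ.exists_mem_branchLabels v s
    rw [τ.mem_labelsOf_iff (fun _ h => h.1) hφ hs]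
    refine ⟨fun h => h.2 hs, fun h => ⟨hφ, (hcut φ hφ).resolve_right fun h' => ?_⟩⟩
    exact Set.disjoint_left.1 hCD h (h' hs)
  have hpA := hpull A B hd hcut
  have hpB := hpull B A hd.symm fun φ hφ => (hcut φ hφ).symm
  have hdisj : Disjoint (pull A) (pull B) := by
    rw [Set.disjoint_left]
    intro φ h1 h2
    obtain ⟨s, hs⟩ := hne φ h1.1
    exact Set.disjoint_left.1 hd (h1.2 hs) (h2.2 hs)
  have nonempty_of : ∀ C, τ.labelsOf v (pull C) = C → C.Nonempty → (pull C).Nonempty := by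
    intro C hC hCne
    by_contra h
    rw [Set.not_nonempty_iff_eq_empty] at h
    rw [← hC, h] at hCne
    simp [labelsOf] at hCne
  have hnA := nonempty_of A hpA hA
  refine ⟨{pull A, pull B}, ⟨_, _, rfl, fun h => hnA.ne_empty (disjoint_self.1 (h ▸ hdisj)), hnA,
    nonempty_of B hpB hB, hdisj, ?_⟩, ?_⟩
  · ext φ
    constructor
    · rintro (h | h) <;> exact h.1
    · exact fun h => (hcut φ h).imp (⟨h, ·⟩) (⟨h, ·⟩)
  · rw [inducedSPart_eq_image, Set.image_pair, hpA, hpB]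

end LTree

section Ring

variable {γ : Type} (W : Set γ) (k : Type) [CommRing k]

theorem lvar_of_stable {σ : Set (Set γ)} (h : PaintedStablePart W σ) :
    lvar γ W k σ = MvPolynomial.X ⟨σ, h⟩ := dif_pos h

variable [Finite γ]

theorem lvar_dvd_mFam {E : Set (Set (Set γ))} {σ : Set (Set γ)} (h : σ ∈ E) :
    lvar γ W k σ ∣ mFam γ W k E := by
  have : E = insert σ (E \ {σ}) := by simp [h]
  rw [mFam, this, finprod_mem_insert _ (by simp) (Set.toFinite _)]
  exact Dvd.intro _ rfl

theorem mFam_union_singleton {E : Set (Set (Set γ))} {σ : Set (Set γ)} (h : σ ∉ E) :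
    mFam γ W k (E ∪ {σ}) = lvar γ W k σ * mFam γ W k E := by
  rw [Set.union_singleton, mFam, finprod_mem_insert _ h (Set.toFinite _), mFam]

theorem mFam_eq_zero {E : Set (Set (Set γ))} {σ : Set (Set γ)} (h : σ ∈ E)
    (hσ : ¬ PaintedStablePart W σ) : mFam γ W k E = 0 := by
  have := lvar_dvd_mFam W k h
  rwa [lvar, dif_neg hσ, zero_dvd_iff] at this

/-- A variable whose 2-partition splits labels from four different branches at `v`, but is not
induced by a 2-partition of the flags at `v`, is killed by `m(τ)` modulo `I_S`. -/
theorem X_mul_mFam_mem {τ : LTree γ} (hE : ∀ σ ∈ τ.edgeFamily, PaintedStablePart W σ)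
    {v : τ.V} (hne : ∀ φ ∈ τ.flagsAt v, (τ.branchLabels v φ).Nonempty) {I J K L : τ.Fl}
    (hI : I ∈ τ.flagsAt v) (hJ : J ∈ τ.flagsAt v) (hK : K ∈ τ.flagsAt v)
    (hL : L ∈ τ.flagsAt v) (hIJ : I ≠ J) (hIK : I ≠ K) (hJL : J ≠ L) (hKL : K ≠ L)
    {i j a b : γ} (hi : i ∈ τ.branchLabels v I) (hj : j ∈ τ.branchLabels v J)
    (ha : a ∈ τ.branchLabels v K) (hb : b ∈ τ.branchLabels v L) (hal : Allowed W i j a b)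
    (σ : PSP γ W) (hσ : SplitsPair σ.1 i j a b)
    (hind : ∀ α ∈ τ.VertexParts W v, τ.inducedSPart v α ≠ σ.1) :
    MvPolynomial.X σ * mFam γ W k τ.edgeFamily ∈ idealI γ W k := by
  obtain ⟨A, hA, B, hB, hAB, hiA, hjA, haB, hbB⟩ := hσ
  have hd := σ.2.1.disjoint hA hB hAB
  obtain ⟨hσ, hu⟩ := σ.2.1.eq_pair hA hB hAB
  obtain ⟨φ, hφ, hcA, hcB⟩ : ∃ φ ∈ τ.flagsAt v,
      ¬ τ.branchLabels v φ ⊆ A ∧ ¬ τ.branchLabels v φ ⊆ B := by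
    by_contra! hcut
    obtain ⟨α, h1, h2⟩ := τ.exists_inducedSPart_eq hne ⟨i, hiA⟩ ⟨a, haB⟩ hd
      fun φ hφ => or_iff_not_imp_left.2 (hcut φ hφ)
    rw [← hσ] at h2
    exact hind α ⟨h1, h2 ▸ σ.2⟩ h2
  obtain ⟨y, hyT, hyA⟩ := Set.not_subset.1 hcA
  obtain ⟨x, hxT, hxB⟩ := Set.not_subset.1 hcB
  have hxA : x ∈ A := (hu ▸ Set.mem_univ x : x ∈ A ∪ B).resolve_right hxB
  have hyB : y ∈ B := (hu ▸ Set.mem_univ y : y ∈ A ∪ B).resolve_left hyA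
  have hφe : τ.inv φ ≠ φ := by
    intro h
    rw [τ.branchLabels_of_fixed h] at hxT hyT
    exact hyA (τ.label_inj (hxT.trans hyT.symm) ▸ hxA)
  have hmem : τ.flagPartition φ ∈ τ.edgeFamily := ⟨φ, hφe, rfl⟩
  have hstab := hE _ hmem
  have hT : τ.branchLabels v φ = τ.flagSide (τ.inv φ) := τ.branchLabels_eq_flagSide hφ hφe
  have hcompl : ∀ s, s ∉ τ.branchLabels v φ → s ∈ τ.flagSide φ := fun s hs =>
    (τ.flagSide_union φ ▸ Set.mem_univ s :
      s ∈ τ.flagSide φ ∪ τ.flagSide (τ.inv φ)).resolve_right (hT ▸ hs)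
  obtain ⟨w, hwT, hw⟩ := (hstab.2 (τ.flagSide (τ.inv φ)) (.inr rfl)).1
  have sep : ∀ {M N : τ.Fl} {s t : γ}, M ∈ τ.flagsAt v → N ∈ τ.flagsAt v → M ≠ N →
      s ∈ τ.branchLabels v M → t ∈ τ.branchLabels v N →
      s ∈ τ.branchLabels v φ → t ∉ τ.branchLabels v φ := by
    intro M N s t hM hN hMN hs ht h1 h2
    exact hMN ((τ.eq_of_mem_branchLabels hM hφ hs h1).trans
      (τ.eq_of_mem_branchLabels hφ hN h2 ht))
  obtain ⟨p, hp, q, hq, r, hr, s, hs, hwhite⟩ := exists_crossing_white hal hu hiA hjA haB hbB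
    (sep hI hJ hIJ hi hj) (sep hI hK hIK hi ha) (sep hJ hL hJL hj hb) (sep hK hL hKL ha hb)
    ⟨hxA, hxT⟩ ⟨hyB, hyT⟩ hw (hT ▸ hwT)
  have hgen : MvPolynomial.X σ * MvPolynomial.X ⟨_, hstab⟩ ∈ idealI γ W k := by
    refine Ideal.subset_span (.inr ⟨σ, ⟨_, hstab⟩, ⟨p, q, r, s, ?_, ?_, ?_⟩, rfl⟩)
    · have hAB' : ∀ {c d}, c ∈ A → d ∈ B → c ≠ d := fun hc hd' h =>
        Set.disjoint_left.1 hd hc (h ▸ hd')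
      have hTT : ∀ {c d}, c ∈ τ.branchLabels v φ → d ∉ τ.branchLabels v φ → c ≠ d :=
        fun hc hd' h => hd' (h ▸ hc)
      refine ⟨hTT hp.2 hq.2, hAB' hp.1 hr.1, hAB' hp.1 hs.1, hAB' hq.1 hr.1, hAB' hq.1 hs.1,
        (hTT hs.2 hr.2).symm, ?_⟩
      tauto
    · exact ⟨A, hA, B, hB, hAB, hp.1, hq.1, hr.1, hs.1⟩
    · refine ⟨τ.flagSide φ, .inl rfl, τ.flagSide (τ.inv φ), .inr rfl, fun h => ?_,
        hcompl r hr.2, hcompl q hq.2, hT ▸ hp.2, hT ▸ hs.2⟩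
      exact Set.disjoint_left.1 (τ.disjoint_flagSide hφe) (hcompl q hq.2)
        (h ▸ hcompl q hq.2)
  obtain ⟨c, hc⟩ := lvar_dvd_mFam W k hmem
  rw [hc, lvar_of_stable W k hstab, ← mul_assoc]
  exact Ideal.mul_mem_right _ _ hgen

end Ring

/-- For a painted stable `S`-tree `τ`, a vertex `v` and an allowed
quadruple `(I,J,K,L)` of flags at `v`, the standard relation
`Σ_α ε(α; I,J,K,L) m(τ(α))` (the sum over painted stable 2-partitions `α` of the set
of flags at `v`, with `τ(α)` having edge family `E_τ ∪ {σ_α}`) lies in `I_S`. -/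
theorem standard_relation_mem_idealI {γ : Type} [Finite γ] (W : Set γ)
    (k : Type) [CommRing k]
    (h3 : 3 ≤ Nat.card γ) (hW : 2 ≤ W.ncard)
    (τ : LTree γ) (hτ : τ.PaintedStable W)
    (v : τ.V) (I J K L : τ.Fl) (hIJKL : τ.AllowedFlags W v I J K L) :
    (∑ᶠ α ∈ τ.VertexParts W v,
      eps α I J K L • mFam γ W k (τ.edgeFamily ∪ {τ.inducedSPart v α})) ∈ idealI γ W k := by
  obtain ⟨hI, hJ, hK, hL, hIJ, hIK, hIL, hJK, hJL, hKL, i, hi, j, hj, a, ha, b, hb, hal⟩ := hIJKL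
  by_cases hE : ∀ σ ∈ τ.edgeFamily, PaintedStablePart W σ
  swap
  · push Not at hE
    obtain ⟨σ, hσE, hσ⟩ := hE
    have : ∀ α, mFam γ W k (τ.edgeFamily ∪ {τ.inducedSPart v α}) = 0 := fun α =>
      mFam_eq_zero W k (.inl hσE) hσ
    simp only [this, smul_zero, finsum_zero, zero_mem]
  have hne : ∀ φ ∈ τ.flagsAt v, (τ.branchLabels v φ).Nonempty := by
    intro φ hφ
    by_cases h : τ.inv φ = φ
    · obtain ⟨s, hs⟩ := τ.label_surj φ h
      exact ⟨s, .inl hs⟩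
    · rw [τ.branchLabels_eq_flagSide hφ h]
      exact ((hE _ ⟨φ, h, rfl⟩).2 _ (.inr rfl)).1.mono Set.inter_subset_left
  have heps : ∀ α ∈ τ.VertexParts W v,
      eps α I J K L = eps (τ.inducedSPart v α) i j a b := by
    intro α hα
    simp only [eps, τ.splitsPair_inducedSPart_iff hα.1 hI hJ hK hL hi hj ha hb,
      τ.splitsPair_inducedSPart_iff hα.1 hK hJ hI hL ha hj hi hb]
  have hedge : ∀ σ ∈ τ.edgeFamily, eps σ i j a b = 0 := by
    rintro _ ⟨f, hf, rfl⟩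
    rw [eps, if_neg (τ.not_splitsPair_flagPartition hf hI hJ hK hL hIJ hKL hi hj ha hb),
      if_neg (τ.not_splitsPair_flagPartition hf hK hJ hI hL hJK.symm hIL ha hj hi hb)]
  have hinj : Set.InjOn (τ.inducedSPart v) (τ.VertexParts W v) := by
    intro α hα β hβ h
    exact (τ.labelsOf_injOn hne).image_eq_image_iff (fun _ => hα.1.subset)
      (fun _ => hβ.1.subset) |>.1 h
  let M := mFam γ W k τ.edgeFamily
  let term : Set (Set γ) → Rring γ W k := fun σ => eps σ i j a b • (lvar γ W k σ * M)
  have hsum : ∑ᶠ α ∈ τ.VertexParts W v,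
      eps α I J K L • mFam γ W k (τ.edgeFamily ∪ {τ.inducedSPart v α}) =
      ∑ᶠ σ ∈ τ.inducedSPart v '' τ.VertexParts W v, term σ := by
    rw [finsum_mem_image hinj]
    refine finsum_mem_congr rfl fun α hα => ?_
    rw [heps α hα]
    by_cases hmem : τ.inducedSPart v α ∈ τ.edgeFamily
    · simp [term, hedge _ hmem]
    · rw [mFam_union_singleton W k hmem]
  have hout : ∀ σ, σ ∉ τ.inducedSPart v '' τ.VertexParts W v → term σ ∈ idealI γ W k := by
    intro σ hσ
    by_cases hst : PaintedStablePart W σ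
    swap
    · simp [term, lvar, hst]
    have hind : ∀ α ∈ τ.VertexParts W v, τ.inducedSPart v α ≠ σ := fun α hα h =>
      hσ ⟨α, hα, h⟩
    simp only [term, M, lvar_of_stable W k hst, eps]
    split_ifs with h1 h2
    · rw [one_smul]
      exact X_mul_mFam_mem W k hE hne hI hJ hK hL hIJ hIK hJL hKL hi hj ha hb hal ⟨σ, hst⟩ h1 hind
    · rw [neg_smul, one_smul]
      exact neg_mem (X_mul_mFam_mem W k hE hne hK hJ hI hL hJK.symm hIK.symm hJL hIL
        ha hj hi hb hal.swap ⟨σ, hst⟩ h2 hind)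
    · simp
  have htotal : ∑ᶠ σ, term σ ∈ idealI γ W k := by
    have : ∑ᶠ σ, term σ = Rquad γ W k i j a b * M := by
      rw [Rquad, finsum_mul' _ _ (Set.toFinite _)]
      have hsub : ∀ σ : PSP γ W, eps σ.1 i j a b • MvPolynomial.X σ * M = term σ.1 := fun σ => by
        simp only [term, lvar_of_stable W k σ.2, smul_mul_assoc]
      simp_rw [hsub]
      refine Eq.trans ?_ (finsum_set_coe_eq_finsum_mem (f := term) {σ | PaintedStablePart W σ}).symm
      rw [finsum_mem_def]
      refine finsum_congr fun σ => (Set.indicator_apply_eq_self.2 fun hσ => ?_).symm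
      simp [term, lvar, show ¬ PaintedStablePart W σ from hσ]
    rw [this]
    exact Ideal.mul_mem_right _ _ (Ideal.subset_span (.inl ⟨i, j, a, b, hal, rfl⟩))
  rw [hsum]
  rw [← finsum_mem_univ, ← Set.union_compl_self (τ.inducedSPart v '' τ.VertexParts W v),
    finsum_mem_union disjoint_compl_right (Set.toFinite _) (Set.toFinite _)] at htotal
  refine (Ideal.add_mem_iff_left _ ?_).1 htotal
  exact finsum_mem_induction (· ∈ idealI γ W k) (zero_mem _) (fun _ _ => add_mem)
    fun σ hσ => hout σ hσ

end EMO
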